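/- Fix one of the two signs ±. There exists a constant C > 0 such that for every Schwartz function f on ℝ, every real t ≠ 0, every μ ∈ (0,1] and every ε ∈ (0,1], one has ‖e^{±(t/ε) ∂ₓ/√(1+μD²/3)} f‖_{L^∞(ℝ)} ≤ C μ^{-1/3} (ε/|t|)^{1/3} ‖(1 + μD²)^{5/6} f‖_{L¹(ℝ)}. -/

import Mathlib

open MeasureTheory Real Complex
open scoped ENNReal

/-- One-dimensional Fourier transform with the convention
`f̂(ξ) = (2π)^{-1/2} ∫ e^{-i x ξ} f(x) dx`. -/
noncomputable def ft1 (f : ℝ → ℂ) (ξ : ℝ) : ℂ :=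
  (((2 * π) ^ (-(1 : ℝ) / 2) : ℝ) : ℂ) * ∫ x : ℝ, Complex.exp (-Complex.I * (x * ξ : ℝ)) * f x

/-- One-dimensional Fourier multiplier `m(D) f (x) = (2π)^{-1/2} ∫ e^{i x ξ} m(ξ) f̂(ξ) dξ`. -/
noncomputable def fmult1 (m : ℝ → ℂ) (f : ℝ → ℂ) (x : ℝ) : ℂ :=
  (((2 * π) ^ (-(1 : ℝ) / 2) : ℝ) : ℂ) *
    ∫ ξ : ℝ, Complex.exp (Complex.I * (x * ξ : ℝ)) * m ξ * ft1 f ξ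

/-- Symbol `e^{σ i τ ξ (1 + μ ξ²/3)^{-1/2}}` of the free propagator
`e^{σ τ ∂ₓ/√(1+μD²/3)}` of the linearized 1D classical Boussinesq system (`σ = ±1`). -/
noncomputable def prop1 (σ τ μ : ℝ) (ξ : ℝ) : ℂ :=
  Complex.exp (Complex.I * ((σ * τ * ξ / Real.sqrt (1 + μ * ξ ^ 2 / 3) : ℝ) : ℂ))


/-- First-derivative van der Corput estimate. -/
lemma vdc_first (φ φ' φ'' : ℝ → ℝ) (h1 : ∀ x, HasDerivAt φ (φ' x) x)
    (h2 : ∀ x, HasDerivAt φ' (φ'' x) x) (h3 : Continuous φ'') (c b m : ℝ) (hcb : c ≤ b)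
    (hm : 0 < m) (hφ' : ∀ x ∈ Set.Icc c b, m ≤ φ' x) (hφ'' : ∀ x ∈ Set.Icc c b, 0 ≤ φ'' x) :
    ‖∫ x in c..b, Complex.exp (Complex.I * (φ x : ℂ))‖ ≤ 2 / m := by
  have cφ' : Continuous φ' := continuous_iff_continuousAt.2 fun x => (h2 x).continuousAt
  have cφ : Continuous φ := continuous_iff_continuousAt.2 fun x => (h1 x).continuousAt
  have hpos : ∀ x ∈ Set.Icc c b, 0 < φ' x := fun x hx => hm.trans_le (hφ' x hx)
  have hinv : ∀ x ∈ Set.uIcc c b, HasDerivAt (fun y => (φ' y)⁻¹) (-φ'' x / (φ' x) ^ 2) x := by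
    intro x hx
    rw [Set.uIcc_of_le hcb] at hx
    exact (h2 x).inv (hpos x hx).ne'
  have hinvC : ∀ x ∈ Set.uIcc c b, HasDerivAt (fun y => (((φ' y)⁻¹ : ℝ) : ℂ))
      ((-φ'' x / (φ' x) ^ 2 : ℝ) : ℂ) x := fun x hx => (hinv x hx).ofReal_comp
  have hv : ∀ x ∈ Set.uIcc c b, HasDerivAt (fun y => -Complex.I * Complex.exp (Complex.I * (φ y : ℂ)))
      (φ' x * Complex.exp (Complex.I * (φ x : ℂ))) x := by
    intro x _
    have := (((h1 x).ofReal_comp.const_mul Complex.I).cexp).const_mul (-Complex.I)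
    refine this.congr_deriv ?_
    linear_combination (-(φ' x : ℂ) * Complex.exp (Complex.I * (φ x : ℂ))) * Complex.I_sq
  have cq : ContinuousOn (fun x => -φ'' x / (φ' x) ^ 2) (Set.uIcc c b) := by
    refine ContinuousOn.div (by fun_prop) (by fun_prop) ?_
    intro x hx
    rw [Set.uIcc_of_le hcb] at hx
    exact pow_ne_zero _ (hpos x hx).ne'
  have hu' : IntervalIntegrable (fun x => ((-φ'' x / (φ' x) ^ 2 : ℝ) : ℂ)) volume c b :=
    (Complex.continuous_ofReal.comp_continuousOn cq).intervalIntegrable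
  have hv' : IntervalIntegrable (fun x => (φ' x * Complex.exp (Complex.I * (φ x : ℂ)))) volume c b :=
    Continuous.intervalIntegrable (by fun_prop) _ _
  have key := intervalIntegral.integral_mul_deriv_eq_deriv_mul hinvC hv hu' hv'
  have e1 : ∫ x in c..b, Complex.exp (Complex.I * (φ x : ℂ)) =
      ∫ x in c..b, (((φ' x)⁻¹ : ℝ) : ℂ) * (φ' x * Complex.exp (Complex.I * (φ x : ℂ))) := by
    refine intervalIntegral.integral_congr fun x hx => ?_
    rw [Set.uIcc_of_le hcb] at hx
    have : (φ' x : ℂ) ≠ 0 := by exact_mod_cast (hpos x hx).ne'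
    push_cast
    field_simp
  have e2 : ∫ x in c..b, (-φ'' x / (φ' x) ^ 2) = (φ' b)⁻¹ - (φ' c)⁻¹ :=
    intervalIntegral.integral_eq_sub_of_hasDerivAt hinv cq.intervalIntegrable
  have nexp : ∀ x, ‖-Complex.I * Complex.exp (Complex.I * (φ x : ℂ))‖ = 1 := by
    intro x
    rw [norm_mul, mul_comm Complex.I, Complex.norm_exp_ofReal_mul_I]; simp
  have hb := hpos b ⟨hcb, le_rfl⟩
  have hc := hpos c ⟨le_rfl, hcb⟩
  have e3 : ‖∫ x in c..b, ((-φ'' x / (φ' x) ^ 2 : ℝ) : ℂ) *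
      (-Complex.I * Complex.exp (Complex.I * (φ x : ℂ)))‖ ≤ (φ' c)⁻¹ - (φ' b)⁻¹ := by
    have : (φ' c)⁻¹ - (φ' b)⁻¹ = ∫ x in c..b, -(-φ'' x / (φ' x) ^ 2) := by
      rw [intervalIntegral.integral_neg, e2]; ring
    rw [this]
    refine intervalIntegral.norm_integral_le_of_norm_le hcb ?_ cq.neg.intervalIntegrable
    refine Filter.Eventually.of_forall fun x hx => ?_
    rw [norm_mul, nexp, mul_one, Complex.norm_real, Real.norm_eq_abs, abs_of_nonpos]
    have := hφ'' x ⟨hx.1.le, hx.2⟩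
    exact div_nonpos_of_nonpos_of_nonneg (by linarith) (by positivity)
  rw [e1, key]
  have n1 : ‖(((φ' b)⁻¹ : ℝ) : ℂ) * (-Complex.I * Complex.exp (Complex.I * (φ b : ℂ)))‖ = (φ' b)⁻¹ := by
    rw [norm_mul, nexp, mul_one, Complex.norm_real, Real.norm_eq_abs, abs_of_pos (by positivity)]
  have n2 : ‖(((φ' c)⁻¹ : ℝ) : ℂ) * (-Complex.I * Complex.exp (Complex.I * (φ c : ℂ)))‖ = (φ' c)⁻¹ := by
    rw [norm_mul, nexp, mul_one, Complex.norm_real, Real.norm_eq_abs, abs_of_pos (by positivity)]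
  have hle : (φ' c)⁻¹ ≤ m⁻¹ := inv_anti₀ hm (hφ' c ⟨le_rfl, hcb⟩)
  calc _ ≤ _ + _ := norm_sub_le _ _
    _ ≤ (_ + _) + _ := by gcongr; exact norm_sub_le _ _
    _ ≤ ((φ' b)⁻¹ + (φ' c)⁻¹) + ((φ' c)⁻¹ - (φ' b)⁻¹) := by rw [n1, n2]; gcongr
    _ = 2 * (φ' c)⁻¹ := by ring
    _ ≤ 2 / m := by rw [div_eq_mul_inv]; gcongr

lemma norm_osc_le (φ : ℝ → ℝ) (a b : ℝ) (hab : a ≤ b) :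
    ‖∫ x in a..b, Complex.exp (Complex.I * (φ x : ℂ))‖ ≤ b - a := by
  have := intervalIntegral.norm_integral_le_of_norm_le_const (a := a) (b := b) (C := 1)
    (f := fun x => Complex.exp (Complex.I * (φ x : ℂ))) (fun x _ => by
      rw [mul_comm Complex.I, Complex.norm_exp_ofReal_mul_I])
  rwa [one_mul, abs_of_nonneg (by linarith)] at this

lemma vdc_half (φ φ' φ'' : ℝ → ℝ) (h1 : ∀ x, HasDerivAt φ (φ' x) x)
    (h2 : ∀ x, HasDerivAt φ' (φ'' x) x) (h3 : Continuous φ'') (c b s : ℝ) (hcb : c ≤ b)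
    (hs : 0 < s) (hc : 0 ≤ φ' c) (hφ'' : ∀ x ∈ Set.Icc c b, 1 ≤ φ'' x * s ^ 2) :
    ‖∫ x in c..b, Complex.exp (Complex.I * (φ x : ℂ))‖ ≤ 3 * s := by
  have cφ : Continuous φ := continuous_iff_continuousAt.2 fun x => (h1 x).continuousAt
  have hpp : ∀ x ∈ Set.Icc c b, 1 / s ^ 2 ≤ φ'' x := by
    intro x hx
    rw [div_le_iff₀ (by positivity)]; exact hφ'' x hx
  rcases le_total b (c + s) with h | h
  · exact (norm_osc_le φ c b hcb).trans (by linarith)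
  have hsplit := intervalIntegral.integral_add_adjacent_intervals (μ := volume)
    (f := fun x => Complex.exp (Complex.I * (φ x : ℂ))) (a := c) (b := c + s) (c := b)
    (Continuous.intervalIntegrable (by fun_prop) _ _)
    (Continuous.intervalIntegrable (by fun_prop) _ _)
  rw [← hsplit]
  have hlow : ∀ x ∈ Set.Icc (c + s) b, 1 / s ≤ φ' x := by
    intro x hx
    have hcx : c ≤ x := by linarith [hx.1]
    have := Convex.mul_sub_le_image_sub_of_le_deriv (D := Set.Icc c b) (convex_Icc c b) (f := φ')
      (C := 1 / s ^ 2) (fun y _ => (h2 y).continuousAt.continuousWithinAt)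
      (fun y _ => (h2 y).differentiableAt.differentiableWithinAt)
      (fun y hy => by
        rw [(h2 y).deriv]; exact hpp y (interior_subset hy))
      c ⟨le_rfl, hcb⟩ x ⟨hcx, hx.2⟩ hcx
    have h5 : 1 / s ^ 2 * s ≤ 1 / s ^ 2 * (x - c) := by
      gcongr; linarith [hx.1]
    have h6 : 1 / s ^ 2 * s = 1 / s := by field_simp
    linarith
  have hA := vdc_first φ φ' φ'' h1 h2 h3 (c + s) b (1 / s) h (by positivity) hlow
    (fun x hx => le_trans (by positivity) (hpp x ⟨by linarith [hx.1], hx.2⟩))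
  have hB := norm_osc_le φ c (c + s) (by linarith)
  have : 2 / (1 / s) = 2 * s := by field_simp
  refine (norm_add_le _ _).trans ?_
  linarith

lemma vdc_half_left (φ φ' φ'' : ℝ → ℝ) (h1 : ∀ x, HasDerivAt φ (φ' x) x)
    (h2 : ∀ x, HasDerivAt φ' (φ'' x) x) (h3 : Continuous φ'') (a c s : ℝ) (hac : a ≤ c)
    (hs : 0 < s) (hc : φ' c ≤ 0) (hφ'' : ∀ x ∈ Set.Icc a c, 1 ≤ φ'' x * s ^ 2) :
    ‖∫ x in a..c, Complex.exp (Complex.I * (φ x : ℂ))‖ ≤ 3 * s := by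
  have := vdc_half (fun x => φ (-x)) (fun x => -φ' (-x)) (fun x => φ'' (-x))
    (fun x => by
      have := (h1 (-x)).comp x (hasDerivAt_neg x)
      rw [mul_neg_one] at this
      exact this)
    (fun x => by
      have := ((h2 (-x)).comp x (hasDerivAt_neg x)).neg
      rw [mul_neg_one, neg_neg] at this
      exact this)
    (by fun_prop) (-c) (-a) s (by linarith) hs (by simpa using hc)
    (fun x hx => hφ'' (-x) ⟨by linarith [hx.2], by linarith [hx.1]⟩)
  have e := intervalIntegral.integral_comp_neg (a := -c) (b := -a)
    (f := fun x => Complex.exp (Complex.I * (φ x : ℂ)))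
  simp only [neg_neg] at e
  rw [← e]
  exact this

/-- Second-derivative van der Corput estimate. -/
lemma vdc_second (φ φ' φ'' : ℝ → ℝ) (h1 : ∀ x, HasDerivAt φ (φ' x) x)
    (h2 : ∀ x, HasDerivAt φ' (φ'' x) x) (h3 : Continuous φ'') (a b s : ℝ) (hab : a ≤ b)
    (hs : 0 < s) (hφ'' : ∀ x ∈ Set.Icc a b, 1 ≤ φ'' x * s ^ 2) :
    ‖∫ x in a..b, Complex.exp (Complex.I * (φ x : ℂ))‖ ≤ 6 * s := by
  have cφ : Continuous φ := continuous_iff_continuousAt.2 fun x => (h1 x).continuousAt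
  have cφ' : Continuous φ' := continuous_iff_continuousAt.2 fun x => (h2 x).continuousAt
  rcases le_total 0 (φ' a) with ha | ha
  · exact (vdc_half φ φ' φ'' h1 h2 h3 a b s hab hs ha hφ'').trans (by linarith)
  rcases le_total (φ' b) 0 with hb | hb
  · exact (vdc_half_left φ φ' φ'' h1 h2 h3 a b s hab hs hb hφ'').trans (by linarith)
  obtain ⟨c, hc, hc0⟩ := intermediate_value_Icc hab cφ'.continuousOn ⟨ha, hb⟩
  have hsplit := intervalIntegral.integral_add_adjacent_intervals (μ := volume)
    (f := fun x => Complex.exp (Complex.I * (φ x : ℂ))) (a := a) (b := c) (c := b)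
    (Continuous.intervalIntegrable (by fun_prop) _ _)
    (Continuous.intervalIntegrable (by fun_prop) _ _)
  rw [← hsplit]
  have hA := vdc_half φ φ' φ'' h1 h2 h3 c b s hc.2 hs hc0.ge
    (fun x hx => hφ'' x ⟨hc.1.trans hx.1, hx.2⟩)
  have hB := vdc_half_left φ φ' φ'' h1 h2 h3 a c s hc.1 hs hc0.le
    (fun x hx => hφ'' x ⟨hx.1, hx.2.trans hc.2⟩)
  refine (norm_add_le _ _).trans ?_
  linarith

lemma conj_osc (x : ℝ) : (starRingEnd ℂ) (Complex.exp (Complex.I * (x : ℂ))) =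
    Complex.exp (Complex.I * ((-x : ℝ) : ℂ)) := by
  rw [← Complex.exp_conj]; simp

lemma vdc_second_neg (φ φ' φ'' : ℝ → ℝ) (h1 : ∀ x, HasDerivAt φ (φ' x) x)
    (h2 : ∀ x, HasDerivAt φ' (φ'' x) x) (h3 : Continuous φ'') (a b s : ℝ) (hab : a ≤ b)
    (hs : 0 < s) (hφ'' : ∀ x ∈ Set.Icc a b, 1 ≤ -φ'' x * s ^ 2) :
    ‖∫ x in a..b, Complex.exp (Complex.I * (φ x : ℂ))‖ ≤ 6 * s := by
  have := vdc_second (fun x => -φ x) (fun x => -φ' x) (fun x => -φ'' x)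
    (fun x => (h1 x).neg) (fun x => (h2 x).neg) h3.neg a b s hab hs hφ''
  have e : ∫ x in a..b, Complex.exp (Complex.I * ((-φ x : ℝ) : ℂ)) =
      (starRingEnd ℂ) (∫ x in a..b, Complex.exp (Complex.I * (φ x : ℂ))) := by
    simp only [intervalIntegral.integral_of_le hab, ← integral_conj, conj_osc]
  rw [e, RCLike.norm_conj] at this
  exact this

noncomputable def bqR (η : ℝ) : ℝ := Real.sqrt (1 + η ^ 2 / 3)

lemma bqR_sq (η : ℝ) : bqR η ^ 2 = 1 + η ^ 2 / 3 := Real.sq_sqrt (by positivity)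

lemma bqR_pos (η : ℝ) : 0 < bqR η := Real.sqrt_pos.2 (by positivity)

lemma bqR_deriv (η : ℝ) : HasDerivAt bqR (η / (3 * bqR η)) η := by
  have h : HasDerivAt (fun y : ℝ => 1 + y ^ 2 / 3) (2 * η / 3) η := by
    have := ((hasDerivAt_pow 2 η).div_const 3).const_add 1
    simpa using this
  have := h.sqrt (by positivity)
  refine this.congr_deriv ?_
  have hp := bqR_pos η
  unfold bqR at *
  field_simp

lemma bqR_cont : Continuous bqR := by unfold bqR; fun_prop

lemma bqH_deriv (η : ℝ) : HasDerivAt (fun y => y / bqR y) (1 / bqR η ^ 3) η := by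
  have := (hasDerivAt_id η).div (bqR_deriv η) (bqR_pos η).ne'
  refine this.congr_deriv ?_
  have hp := bqR_pos η
  have hsq := bqR_sq η
  simp only [id]
  field_simp
  linarith

lemma bqH_deriv2 (η : ℝ) : HasDerivAt (fun y => 1 / bqR y ^ 3) (-(η / bqR η ^ 5)) η := by
  have := ((bqR_deriv η).pow 3).inv (pow_ne_zero 3 (bqR_pos η).ne')
  simp only [one_div]
  refine this.congr_deriv ?_
  have hp := bqR_pos η
  simp only [Pi.pow_apply]
  field_simp
  push_cast
  ring

lemma bq_lower_small (η : ℝ) (h0 : 0 ≤ η) (h1 : η ≤ 1) : η / 3 ≤ η / bqR η ^ 5 := by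
  have hp := bqR_pos η
  have hsq := bqR_sq η
  have h2 : bqR η ^ 2 ≤ 4 / 3 := by nlinarith
  have h3 : bqR η ≤ 4 / 3 := by nlinarith
  have h5 : bqR η ^ 5 ≤ 3 := by
    calc bqR η ^ 5 = (bqR η ^ 2) ^ 2 * bqR η := by ring
      _ ≤ (4 / 3) ^ 2 * (4 / 3) := by gcongr
      _ ≤ 3 := by norm_num
  gcongr

lemma bq_lower_large (η : ℝ) (h1 : 1 ≤ η) : 1 / (3 * η ^ 4) ≤ η / bqR η ^ 5 := by
  have hp := bqR_pos η
  have hsq := bqR_sq η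
  have h2 : bqR η ^ 2 ≤ 4 / 3 * η ^ 2 := by nlinarith
  have h3 : bqR η ≤ 4 / 3 * η := by
    refine le_of_sq_le_sq ?_ (by positivity)
    nlinarith
  have h5 : bqR η ^ 5 ≤ 3 * η ^ 5 := by
    calc bqR η ^ 5 = (bqR η ^ 2) ^ 2 * bqR η := by ring
      _ ≤ (4 / 3 * η ^ 2) ^ 2 * (4 / 3 * η) := by gcongr
      _ = 64 / 27 * η ^ 5 := by ring
      _ ≤ 3 * η ^ 5 := by gcongr; norm_num
  have : 1 / (3 * η ^ 4) = η / (3 * η ^ 5) := by field_simp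
  rw [this]
  gcongr

/-- The phase. -/
noncomputable def bqPh (a T η : ℝ) : ℝ := a * η + T * (η / bqR η)

lemma bqPh_cont (a T : ℝ) : Continuous (bqPh a T) := by
  unfold bqPh
  have := bqR_cont
  have h : Continuous (fun y => y / bqR y) := continuous_id.div this fun x => (bqR_pos x).ne'
  fun_prop

lemma bq_osc (a T S x : ℝ) (hS : 1 ≤ S) (hT : T = S ^ 6 ∨ T = -S ^ 6) (hx : 0 ≤ x) :
    ‖∫ η in (0 : ℝ)..x, Complex.exp (Complex.I * (bqPh a T η : ℂ))‖ ≤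
      13 * (1 / S ^ 2 + x ^ 2 / S ^ 3) := by
  have hS0 : 0 < S := by linarith
  rcases le_total x (1 / S ^ 2) with h | h
  · refine (norm_osc_le _ _ _ hx).trans ?_
    have : 0 ≤ x ^ 2 / S ^ 3 := by positivity
    have : 0 ≤ 1 / S ^ 2 := by positivity
    linarith
  have cph := bqPh_cont a T
  rw [← intervalIntegral.integral_add_adjacent_intervals (μ := volume)
    (f := fun η => Complex.exp (Complex.I * (bqPh a T η : ℂ))) (a := 0) (b := 1 / S ^ 2) (c := x)
    (Continuous.intervalIntegrable (by fun_prop) _ _)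
    (Continuous.intervalIntegrable (by fun_prop) _ _)]
  have hδ : 0 < 1 / S ^ 2 := by positivity
  have hA := norm_osc_le (bqPh a T) 0 (1 / S ^ 2) hδ.le
  have d1 : ∀ y, HasDerivAt (bqPh a T) (a + T * (1 / bqR y ^ 3)) y := by
    intro y
    have := ((hasDerivAt_id y).const_mul a).add ((bqH_deriv y).const_mul T)
    rw [mul_one] at this
    exact this
  have d2 : ∀ y, HasDerivAt (fun y => a + T * (1 / bqR y ^ 3)) (T * (-(y / bqR y ^ 5))) y := by
    intro y
    exact ((bqH_deriv2 y).const_mul T).const_add a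
  have c3 : Continuous (fun y => T * (-(y / bqR y ^ 5))) := by
    have := bqR_cont
    have h : Continuous (fun y => y / bqR y ^ 5) :=
      continuous_id.div (this.pow 5) fun x => pow_ne_zero _ (bqR_pos x).ne'
    fun_prop
  set s := 2 * (1 / S ^ 2 + x ^ 2 / S ^ 3) with hs
  have hspos : 0 < s := by positivity
  have hs2 : 4 * (S ^ 2 + x ^ 4) ≤ S ^ 6 * s ^ 2 := by
    have e : S ^ 6 * s ^ 2 = 4 * (S + x ^ 2) ^ 2 := by rw [hs]; field_simp; ring
    rw [e]
    have : 0 ≤ S * x ^ 2 := by positivity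
    nlinarith
  have hg : ∀ y ∈ Set.Icc (1 / S ^ 2) x, 1 ≤ (y / bqR y ^ 5) * (S ^ 6 * s ^ 2) := by
    intro y hy
    have hy0 : 0 < y := hδ.trans_le hy.1
    rcases le_total y 1 with h1 | h1
    · have := bq_lower_small y hy0.le h1
      have h4 : (1 / S ^ 2) / 3 ≤ y / bqR y ^ 5 := by linarith [hy.1]
      calc (1 : ℝ) ≤ (1 / S ^ 2) / 3 * (4 * S ^ 2) := by field_simp; norm_num
        _ ≤ (y / bqR y ^ 5) * (S ^ 6 * s ^ 2) := by
          refine mul_le_mul h4 ?_ (by positivity) (le_trans (by positivity) h4)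
          nlinarith [pow_nonneg hx 4]
    · have := bq_lower_large y h1
      have hx1 : 0 < x := by linarith [hy.2]
      have h5 : 1 / (3 * x ^ 4) ≤ 1 / (3 * y ^ 4) := by
        have := hy.2
        gcongr
      have h4 := h5.trans this
      calc (1 : ℝ) ≤ 1 / (3 * x ^ 4) * (4 * x ^ 4) := by field_simp; norm_num
        _ ≤ (y / bqR y ^ 5) * (S ^ 6 * s ^ 2) := by
          refine mul_le_mul h4 ?_ (by positivity) (le_trans (by positivity) h4)
          nlinarith [pow_nonneg hS0.le 2]
  have hB : ‖∫ η in (1 / S ^ 2)..x, Complex.exp (Complex.I * (bqPh a T η : ℂ))‖ ≤ 6 * s := by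
    rcases hT with hT | hT
    · refine vdc_second_neg _ _ _ d1 d2 c3 _ _ s h hspos fun y hy => ?_
      refine (hg y hy).trans_eq ?_
      rw [hT]; ring
    · refine vdc_second _ _ _ d1 d2 c3 _ _ s h hspos fun y hy => ?_
      refine (hg y hy).trans_eq ?_
      rw [hT]; ring
  refine (norm_add_le _ _).trans ?_
  have : 0 ≤ x ^ 2 / S ^ 3 := by positivity
  linarith

/-- The weight. -/
noncomputable def bqW (η : ℝ) : ℝ := (1 + η ^ 2) ^ (-(5 : ℝ) / 6)

noncomputable def bqW' (η : ℝ) : ℝ := -(5 / 3 * η * (1 + η ^ 2) ^ (-(11 : ℝ) / 6))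

lemma bqW_deriv (η : ℝ) : HasDerivAt bqW (bqW' η) η := by
  have h : HasDerivAt (fun y : ℝ => 1 + y ^ 2) (2 * η) η := by
    have := (hasDerivAt_pow 2 η).const_add 1
    simpa using this
  have := h.rpow_const (p := -(5 : ℝ) / 6) (Or.inl (by positivity))
  refine this.congr_deriv ?_
  unfold bqW'
  rw [show (-(5 : ℝ) / 6 - 1) = -(11 : ℝ) / 6 by norm_num]
  ring

lemma bqW_cont : Continuous bqW := continuous_iff_continuousAt.2 fun x => (bqW_deriv x).continuousAt

lemma bqW'_cont : Continuous bqW' := by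
  unfold bqW'
  have : Continuous fun η : ℝ => (1 + η ^ 2) ^ (-(11 : ℝ) / 6) :=
    Continuous.rpow_const (by fun_prop) fun x => Or.inl (by positivity)
  fun_prop

lemma bqW_pos (η : ℝ) : 0 < bqW η := by unfold bqW; positivity

lemma bqW_int : Integrable bqW := by
  have := integrable_rpow_neg_one_add_norm_sq (E := ℝ) (μ := volume) (r := 5 / 3) (by norm_num)
  refine this.congr (Filter.Eventually.of_forall fun x => ?_)
  simp only [bqW, Real.norm_eq_abs, sq_abs]
  norm_num

lemma bqW_le (η : ℝ) (h : 0 < η) : bqW η ≤ η ^ (-(5 : ℝ) / 3) := by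
  have : η ^ (-(5 : ℝ) / 3) = (η ^ 2) ^ (-(5 : ℝ) / 6) := by
    rw [← Real.rpow_natCast, ← Real.rpow_mul h.le]; norm_num
  rw [this]
  exact Real.rpow_le_rpow_of_nonpos (by positivity) (by linarith) (by norm_num)

lemma bqW'_le (η : ℝ) (h : 0 < η) : η ^ 2 * (-bqW' η) ≤ 5 / 3 * η ^ (-(2 : ℝ) / 3) := by
  have e : η ^ (-(2 : ℝ) / 3) = η ^ 3 * (η ^ 2) ^ (-(11 : ℝ) / 6) := by
    rw [← Real.rpow_natCast η 2, ← Real.rpow_mul h.le, ← Real.rpow_natCast η 3,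
      ← Real.rpow_add h]; norm_num
  have h2 : (1 + η ^ 2) ^ (-(11 : ℝ) / 6) ≤ (η ^ 2) ^ (-(11 : ℝ) / 6) :=
    Real.rpow_le_rpow_of_nonpos (by positivity) (by linarith) (by norm_num)
  rw [e]
  unfold bqW'
  calc _ = 5 / 3 * (η ^ 3 * (1 + η ^ 2) ^ (-(11 : ℝ) / 6)) := by ring
    _ ≤ _ := by gcongr

lemma bq_half (a T S : ℝ) (hS : 1 ≤ S) (hT : T = S ^ 6 ∨ T = -S ^ 6) :
    ‖∫ η in Set.Ioi (0 : ℝ), Complex.exp (Complex.I * (bqPh a T η : ℂ)) * (bqW η : ℂ)‖ ≤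
      106 / S ^ 2 := by
  have hS0 : 0 < S := by linarith
  have cph := bqPh_cont a T
  have cw := bqW_cont
  have nexp : ∀ x : ℝ, ‖Complex.exp (Complex.I * (bqPh a T x : ℂ))‖ = 1 := by
    intro x
    rw [mul_comm Complex.I, Complex.norm_exp_ofReal_mul_I]
  have ng : ∀ η, ‖Complex.exp (Complex.I * (bqPh a T η : ℂ)) * (bqW η : ℂ)‖ = bqW η := by
    intro η
    rw [norm_mul, nexp, one_mul, Complex.norm_real, Real.norm_eq_abs, abs_of_pos (bqW_pos η)]
  have hint : Integrable (fun η => Complex.exp (Complex.I * (bqPh a T η : ℂ)) * (bqW η : ℂ)) :=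
    bqW_int.mono' (Continuous.aestronglyMeasurable (by fun_prop))
      (Filter.Eventually.of_forall fun η => (ng η).le)
  set N := S ^ 3 with hN
  have hN0 : 0 < N := by positivity
  have hN5 : N ^ (-(5 : ℝ) / 3) = 1 / S ^ 5 := by
    rw [hN, ← Real.rpow_natCast S 3, ← Real.rpow_mul hS0.le,
      show ((3 : ℕ) : ℝ) * (-(5 : ℝ) / 3) = -((5 : ℕ) : ℝ) by norm_num,
      Real.rpow_neg hS0.le, Real.rpow_natCast, one_div]
  have hN2 : N ^ (-(2 : ℝ) / 3) = 1 / S ^ 2 := by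
    rw [hN, ← Real.rpow_natCast S 3, ← Real.rpow_mul hS0.le,
      show ((3 : ℕ) : ℝ) * (-(2 : ℝ) / 3) = -((2 : ℕ) : ℝ) by norm_num,
      Real.rpow_neg hS0.le, Real.rpow_natCast, one_div]
  have hN1 : N ^ ((1 : ℝ) / 3) = S := by
    rw [hN, ← Real.rpow_natCast S 3, ← Real.rpow_mul hS0.le,
      show ((3 : ℕ) : ℝ) * ((1 : ℝ) / 3) = 1 by norm_num, Real.rpow_one]
  -- tail
  have tail : ‖∫ η in Set.Ioi N, Complex.exp (Complex.I * (bqPh a T η : ℂ)) * (bqW η : ℂ)‖ ≤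
      3 / 2 / S ^ 2 := by
    have hr := integral_Ioi_rpow_of_lt (a := -(5 : ℝ) / 3) (by norm_num) hN0
    have hri := integrableOn_Ioi_rpow_of_lt (a := -(5 : ℝ) / 3) (by norm_num) hN0
    have : ‖∫ η in Set.Ioi N, Complex.exp (Complex.I * (bqPh a T η : ℂ)) * (bqW η : ℂ)‖ ≤
        ∫ η in Set.Ioi N, η ^ (-(5 : ℝ) / 3) := by
      refine norm_integral_le_of_norm_le hri ?_
      refine (ae_restrict_iff' measurableSet_Ioi).2 (Filter.Eventually.of_forall fun η hη => ?_)
      rw [ng]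
      exact bqW_le η (hN0.trans hη)
    refine this.trans_eq ?_
    rw [hr, show (-(5 : ℝ) / 3 + 1) = -(2 : ℝ) / 3 by norm_num, hN2]
    field_simp
  -- main part
  set F : ℝ → ℂ := fun x => ∫ η in (0 : ℝ)..x, Complex.exp (Complex.I * (bqPh a T η : ℂ)) with hF
  have hFd : ∀ x, HasDerivAt F (Complex.exp (Complex.I * (bqPh a T x : ℂ))) x := by
    intro x
    have cE : Continuous fun y : ℝ => Complex.exp (Complex.I * (bqPh a T y : ℂ)) := by fun_prop
    exact intervalIntegral.integral_hasDerivAt_right (cE.intervalIntegrable _ _)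
      (cE.stronglyMeasurableAtFilter _ _) cE.continuousAt
  have cw' := bqW'_cont
  have cF : Continuous F := continuous_iff_continuousAt.2 fun x => (hFd x).continuousAt
  have key := intervalIntegral.integral_mul_deriv_eq_deriv_mul (a := 0) (b := N)
    (u := fun x => (bqW x : ℂ)) (u' := fun x => (bqW' x : ℂ)) (v := F)
    (fun x _ => (bqW_deriv x).ofReal_comp) (fun x _ => hFd x)
    (Continuous.intervalIntegrable (by fun_prop) _ _)
    (Continuous.intervalIntegrable (by fun_prop) _ _)
  have hF0 : F 0 = 0 := by simp [hF]
  have hFb : ∀ x, 0 ≤ x → ‖F x‖ ≤ 13 * (1 / S ^ 2 + x ^ 2 / S ^ 3) :=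
    fun x hx => bq_osc a T S x hS hT hx
  have b1 : ‖(bqW N : ℂ) * F N‖ ≤ 26 / S ^ 2 := by
    rw [norm_mul, Complex.norm_real, Real.norm_eq_abs, abs_of_pos (bqW_pos N)]
    calc _ ≤ (1 / S ^ 5) * (13 * (1 / S ^ 2 + N ^ 2 / S ^ 3)) := by
          refine mul_le_mul ((bqW_le N hN0).trans_eq hN5) (hFb N hN0.le) (norm_nonneg _)
            (by positivity)
      _ = 13 / S ^ 7 + 13 / S ^ 2 := by rw [hN]; field_simp
      _ ≤ 13 / S ^ 2 + 13 / S ^ 2 := by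
          gcongr ?_ + _
          exact div_le_div_of_nonneg_left (by norm_num) (by positivity)
            (pow_le_pow_right₀ hS (by norm_num))
      _ = 26 / S ^ 2 := by ring
  have hir : IntervalIntegrable (fun x : ℝ => x ^ (-(2 : ℝ) / 3)) volume 0 N :=
    intervalIntegral.intervalIntegrable_rpow' (by norm_num)
  have hiw : IntervalIntegrable bqW' volume 0 N := cw'.intervalIntegrable _ _
  have b2 : ‖∫ x in (0 : ℝ)..N, (bqW' x : ℂ) * F x‖ ≤ 78 / S ^ 2 := by
    have : ‖∫ x in (0 : ℝ)..N, (bqW' x : ℂ) * F x‖ ≤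
        ∫ x in (0 : ℝ)..N, ((-13 / S ^ 2) * bqW' x + (65 / 3 / S ^ 3) * x ^ (-(2 : ℝ) / 3)) := by
      refine intervalIntegral.norm_integral_le_of_norm_le hN0.le ?_
        ((hiw.const_mul _).add (hir.const_mul _))
      refine Filter.Eventually.of_forall fun x hx => ?_
      have hneg : bqW' x ≤ 0 := by
        have := hx.1
        unfold bqW'
        rw [neg_nonpos]; positivity
      rw [norm_mul, Complex.norm_real, Real.norm_eq_abs, abs_of_nonpos hneg]
      calc _ ≤ -bqW' x * (13 * (1 / S ^ 2 + x ^ 2 / S ^ 3)) := by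
            refine mul_le_mul_of_nonneg_left (hFb x hx.1.le) (by linarith)
        _ = (-13 / S ^ 2) * bqW' x + 13 / S ^ 3 * (x ^ 2 * (-bqW' x)) := by ring
        _ ≤ (-13 / S ^ 2) * bqW' x + 13 / S ^ 3 * (5 / 3 * x ^ (-(2 : ℝ) / 3)) := by
            exact add_le_add le_rfl (mul_le_mul_of_nonneg_left (bqW'_le x hx.1) (by positivity))
        _ = _ := by ring
    refine this.trans ?_
    rw [intervalIntegral.integral_add (hiw.const_mul _) (hir.const_mul _),
      intervalIntegral.integral_const_mul, intervalIntegral.integral_const_mul,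
      intervalIntegral.integral_eq_sub_of_hasDerivAt (fun x _ => bqW_deriv x) hiw,
      integral_rpow (Or.inl (by norm_num)), show (-(2 : ℝ) / 3 + 1) = (1 : ℝ) / 3 by norm_num, hN1,
      Real.zero_rpow (by norm_num)]
    have w0 : bqW 0 = 1 := by simp [bqW]
    have wN := bqW_pos N
    rw [w0]
    have e : -13 / S ^ 2 * (bqW N - 1) = 13 / S ^ 2 - 13 / S ^ 2 * bqW N := by ring
    have e2 : 65 / 3 / S ^ 3 * ((S - 0) / (1 / 3)) = 65 / S ^ 2 := by field_simp; ring
    rw [e, e2]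
    have : 0 ≤ 13 / S ^ 2 * bqW N := by positivity
    have e3 : 78 / S ^ 2 = 13 / S ^ 2 + 65 / S ^ 2 := by ring
    linarith
  have main : ‖∫ η in (0 : ℝ)..N, Complex.exp (Complex.I * (bqPh a T η : ℂ)) * (bqW η : ℂ)‖ ≤
      104 / S ^ 2 := by
    have e : ∫ η in (0 : ℝ)..N, Complex.exp (Complex.I * (bqPh a T η : ℂ)) * (bqW η : ℂ) =
        ∫ η in (0 : ℝ)..N, (bqW η : ℂ) * Complex.exp (Complex.I * (bqPh a T η : ℂ)) := by
      congr 1; ext; ring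
    rw [e, key, hF0, mul_zero, sub_zero]
    refine (norm_sub_le _ _).trans ?_
    have : 104 / S ^ 2 = 26 / S ^ 2 + 78 / S ^ 2 := by ring
    linarith
  have split := intervalIntegral.integral_interval_add_Ioi (a := 0) (b := N)
    hint.integrableOn (hint.integrableOn (s := Set.Ioi N))
  rw [← split]
  refine (norm_add_le _ _).trans ?_
  have e : 106 / S ^ 2 = 104 / S ^ 2 + 3 / 2 / S ^ 2 + 1 / 2 / S ^ 2 := by ring
  have : 0 ≤ 1 / 2 / S ^ 2 := by positivity
  linarith

lemma bq_full : ∃ C : ℝ, 0 < C ∧ ∀ a T : ℝ, T ≠ 0 →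
    ‖∫ η : ℝ, Complex.exp (Complex.I * (bqPh a T η : ℂ)) * (bqW η : ℂ)‖ ≤
      C * |T| ^ (-(1 : ℝ) / 3) := by
  have hW : 0 ≤ ∫ η, bqW η := integral_nonneg fun x => (bqW_pos x).le
  refine ⟨212 + ∫ η, bqW η, by positivity, fun a T hT => ?_⟩
  have ng : ∀ a T η, ‖Complex.exp (Complex.I * (bqPh a T η : ℂ)) * (bqW η : ℂ)‖ = bqW η := by
    intro a T η
    rw [norm_mul, mul_comm Complex.I, Complex.norm_exp_ofReal_mul_I, one_mul, Complex.norm_real,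
      Real.norm_eq_abs, abs_of_pos (bqW_pos η)]
  have hT0 : 0 < |T| := abs_pos.2 hT
  have hTp : 0 < |T| ^ (-(1 : ℝ) / 3) := by positivity
  rcases le_total |T| 1 with h | h
  · have h1 : 1 ≤ |T| ^ (-(1 : ℝ) / 3) := Real.one_le_rpow_of_pos_of_le_one_of_nonpos hT0 h (by norm_num)
    refine (norm_integral_le_integral_norm _).trans ?_
    simp only [ng]
    nlinarith
  have cph := bqPh_cont a T
  have cw := bqW_cont
  have hint : Integrable (fun η => Complex.exp (Complex.I * (bqPh a T η : ℂ)) * (bqW η : ℂ)) :=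
    bqW_int.mono' (Continuous.aestronglyMeasurable (by fun_prop))
      (Filter.Eventually.of_forall fun η => (ng a T η).le)
  set S := |T| ^ ((1 : ℝ) / 6) with hSdef
  have hS : 1 ≤ S := Real.one_le_rpow h (by norm_num)
  have hS6 : S ^ 6 = |T| := by
    rw [hSdef, ← Real.rpow_natCast, ← Real.rpow_mul hT0.le]; norm_num
  have hS2 : 1 / S ^ 2 = |T| ^ (-(1 : ℝ) / 3) := by
    rw [hSdef, ← Real.rpow_natCast, ← Real.rpow_mul hT0.le, one_div, ← Real.rpow_neg hT0.le]
    norm_num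
  have hTS : T = S ^ 6 ∨ T = -S ^ 6 := by
    rw [hS6]; rcases abs_choice T with h | h <;> rw [h] <;> simp
  have hTS' : -T = S ^ 6 ∨ -T = -S ^ 6 := by
    rcases hTS with h | h
    · right; rw [h]
    · left; rw [h, neg_neg]
  have hA := bq_half a T S hS hTS
  have hB := bq_half (-a) (-T) S hS hTS'
  have e : ∫ η in Set.Ioi (0 : ℝ), Complex.exp (Complex.I * (bqPh (-a) (-T) η : ℂ)) * (bqW η : ℂ) =
      ∫ η in Set.Iic (0 : ℝ), Complex.exp (Complex.I * (bqPh a T η : ℂ)) * (bqW η : ℂ) := by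
    have := integral_comp_neg_Ioi (0 : ℝ)
      (fun η => Complex.exp (Complex.I * (bqPh a T η : ℂ)) * (bqW η : ℂ))
    rw [neg_zero] at this
    rw [← this]
    refine setIntegral_congr_fun measurableSet_Ioi fun η _ => ?_
    have e1 : bqPh (-a) (-T) η = bqPh a T (-η) := by simp [bqPh, bqR]; ring
    have e2 : bqW (-η) = bqW η := by simp [bqW]
    simp only [e1, e2]
  rw [e] at hB
  rw [← intervalIntegral.integral_Iic_add_Ioi (b := 0) hint.integrableOn hint.integrableOn]
  refine (norm_add_le _ _).trans ?_
  have e3 : 106 / S ^ 2 = 106 * |T| ^ (-(1 : ℝ) / 3) := by rw [← hS2]; ring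
  rw [e3] at hA hB
  nlinarith

open scoped FourierTransform

lemma ft1_eq (f : ℝ → ℂ) (η : ℝ) :
    ft1 f (2 * π * η) = (((2 * π) ^ (-(1 : ℝ) / 2) : ℝ) : ℂ) * 𝓕 f η := by
  unfold ft1
  rw [Real.fourier_real_eq_integral_exp_smul]
  congr 2
  ext x
  rw [smul_eq_mul]
  congr 2
  push_cast
  ring

lemma fmult1_eq (m f : ℝ → ℂ) (x : ℝ) :
    fmult1 m f x = ∫ η : ℝ, Complex.exp (Complex.I * (x * (2 * π * η) : ℝ)) *
      m (2 * π * η) * 𝓕 f η := by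
  have h2 : (0 : ℝ) < 2 * π := by positivity
  have h := Measure.integral_comp_mul_left
    (fun ξ : ℝ => Complex.exp (Complex.I * (x * ξ : ℝ)) * m ξ * ft1 f ξ) (2 * π)
  have h' : ∫ ξ : ℝ, Complex.exp (Complex.I * (x * ξ : ℝ)) * m ξ * ft1 f ξ =
      ((2 * π : ℝ) : ℂ) * ∫ η : ℝ, Complex.exp (Complex.I * (x * (2 * π * η) : ℝ)) *
        m (2 * π * η) * ft1 f (2 * π * η) := by
    rw [h, abs_of_pos (by positivity), Complex.real_smul, ← mul_assoc, ← Complex.ofReal_mul,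
      mul_inv_cancel₀ h2.ne', Complex.ofReal_one, one_mul]
  have hc : (((2 * π) ^ (-(1 : ℝ) / 2) : ℝ) : ℂ) * ((2 * π : ℝ) : ℂ) *
      (((2 * π) ^ (-(1 : ℝ) / 2) : ℝ) : ℂ) = 1 := by
    rw [← Complex.ofReal_mul, ← Complex.ofReal_mul]
    have : (2 * π) ^ (-(1 : ℝ) / 2) * (2 * π) * (2 * π) ^ (-(1 : ℝ) / 2) = 1 := by
      nth_rewrite 2 [← Real.rpow_one (2 * π)]
      rw [← Real.rpow_add h2, ← Real.rpow_add h2]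
      norm_num
    rw [this, Complex.ofReal_one]
  unfold fmult1
  rw [h']
  simp only [ft1_eq]
  have e : ∫ η : ℝ, Complex.exp (Complex.I * (x * (2 * π * η) : ℝ)) *
        m (2 * π * η) * ((((2 * π) ^ (-(1 : ℝ) / 2) : ℝ) : ℂ) * 𝓕 f η) =
      (((2 * π) ^ (-(1 : ℝ) / 2) : ℝ) : ℂ) * ∫ η : ℝ,
        Complex.exp (Complex.I * (x * (2 * π * η) : ℝ)) * m (2 * π * η) * 𝓕 f η := by
    rw [← integral_const_mul]
    congr 1; ext; ring
  rw [e, ← mul_assoc, ← mul_assoc, hc, one_mul]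

lemma bq_temperate (k : ℝ) :
    (fun η : ℝ => (((1 + (k * η) ^ 2) ^ ((5 : ℝ) / 6) : ℝ) : ℂ)).HasTemperateGrowth := by
  have h1 := Function.hasTemperateGrowth_one_add_norm_sq_rpow ℝ ((5 : ℝ) / 6)
  have h2 : (fun η : ℝ => k * η).HasTemperateGrowth := by fun_prop
  have h3 := Function.Complex.hasTemperateGrowth_ofReal.comp (h1.comp h2)
  have e : (fun η : ℝ => (((1 + (k * η) ^ 2) ^ ((5 : ℝ) / 6) : ℝ) : ℂ)) =
      Complex.ofReal ∘ ((fun x : ℝ => (1 + ‖x‖ ^ 2) ^ ((5 : ℝ) / 6)) ∘ fun η : ℝ => k * η) := by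
    ext η
    simp only [Function.comp, Real.norm_eq_abs, sq_abs]
  rw [e]
  exact h3

/-- The Schwartz function `(1+μD²)^{5/6} f`. -/
lemma exists_g (f : SchwartzMap ℝ ℂ) (μ : ℝ) (hμ : 0 < μ) : ∃ g : SchwartzMap ℝ ℂ,
    (fmult1 (fun ξ => (((1 + μ * ξ ^ 2) ^ ((5 : ℝ) / 6) : ℝ) : ℂ)) ⇑f = ⇑g) ∧
    ∀ η : ℝ, 𝓕 (⇑f) η = (bqW (2 * π * √μ * η) : ℂ) * 𝓕 (⇑g) η := by
  set k := 2 * π * √μ with hk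
  set M : ℝ → ℂ := fun η : ℝ => (((1 + (k * η) ^ 2) ^ ((5 : ℝ) / 6) : ℝ) : ℂ) with hM
  have hMt : M.HasTemperateGrowth := bq_temperate k
  have hkk : ∀ η : ℝ, μ * (2 * π * η) ^ 2 = (k * η) ^ 2 := by
    intro η
    rw [hk]; linear_combination (-(4 * π ^ 2 * η ^ 2)) * Real.sq_sqrt hμ.le
  refine ⟨𝓕⁻ (SchwartzMap.smulLeftCLM ℂ M (𝓕 f)), ?_, fun η => ?_⟩
  · ext x
    rw [fmult1_eq, SchwartzMap.fourierInv_coe, Real.fourierInv_eq']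
    congr 1
    ext η
    rw [SchwartzMap.smulLeftCLM_apply_apply hMt, SchwartzMap.fourier_coe, hkk, smul_eq_mul,
      smul_eq_mul]
    have : Complex.I * ((x * (2 * π * η) : ℝ) : ℂ) =
        ((2 * π * inner ℝ η x : ℝ) : ℂ) * Complex.I := by
      simp
      ring
    rw [this, mul_assoc]
  · rw [← SchwartzMap.fourier_coe, ← SchwartzMap.fourier_coe, FourierTransform.fourier_fourierInv_eq,
      SchwartzMap.smulLeftCLM_apply_apply hMt, smul_eq_mul, ← mul_assoc, hM]
    simp only [bqW]
    rw [← Complex.ofReal_mul, ← Real.rpow_add (by positivity)]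
    norm_num

lemma bq_kernel (C : ℝ) (hC : ∀ a T : ℝ, T ≠ 0 →
      ‖∫ η : ℝ, Complex.exp (Complex.I * (bqPh a T η : ℂ)) * (bqW η : ℂ)‖ ≤
      C * |T| ^ (-(1 : ℝ) / 3)) (σ : ℝ) (hσ : σ = 1 ∨ σ = -1) (μ τ z : ℝ) (hμ : 0 < μ)
      (hτ : τ ≠ 0) :
    ‖∫ η : ℝ, Complex.exp (Complex.I * (z * (2 * π * η) : ℝ)) * prop1 σ τ μ (2 * π * η) *
      (bqW (2 * π * √μ * η) : ℂ)‖ ≤ C * μ ^ (-(1 : ℝ) / 3) * |τ| ^ (-(1 : ℝ) / 3) := by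
  have hs : 0 < √μ := Real.sqrt_pos.2 hμ
  set k := 2 * π * √μ with hk
  have hkpos : 0 < k := by positivity
  have hσ1 : |σ| = 1 := by rcases hσ with h | h <;> simp [h]
  have hT : σ * τ / √μ ≠ 0 := by
    have : σ ≠ 0 := by rintro rfl; simp at hσ1
    positivity
  have h := hC (z / √μ) (σ * τ / √μ) hT
  have e : ∀ η : ℝ, Complex.exp (Complex.I * (z * (2 * π * η) : ℝ)) * prop1 σ τ μ (2 * π * η) *
      (bqW (k * η) : ℂ) =
      Complex.exp (Complex.I * (bqPh (z / √μ) (σ * τ / √μ) (k * η) : ℂ)) * (bqW (k * η) : ℂ) := by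
    intro η
    unfold prop1
    rw [← Complex.exp_add, ← mul_add, ← Complex.ofReal_add]
    have hR : √(1 + μ * (2 * π * η) ^ 2 / 3) = bqR (k * η) := by
      unfold bqR
      congr 3
      rw [hk]; linear_combination (-(4 * π ^ 2 * η ^ 2)) * Real.sq_sqrt hμ.le
    have hp := bqR_pos (k * η)
    have hph : z * (2 * π * η) + σ * τ * (2 * π * η) / √(1 + μ * (2 * π * η) ^ 2 / 3) =
        bqPh (z / √μ) (σ * τ / √μ) (k * η) := by
      rw [hR]
      unfold bqPh
      have h1 : z / √μ * (k * η) = z * (2 * π * η) := by rw [hk]; field_simp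
      have h2 : σ * τ / √μ * (k * η / bqR (k * η)) = σ * τ * (2 * π * η) / bqR (k * η) := by
        generalize bqR (k * η) = r at *
        rw [hk]; field_simp
      rw [h1, h2]
    rw [hph]
  simp only [e]
  rw [Measure.integral_comp_mul_left
    (fun η => Complex.exp (Complex.I * (bqPh (z / √μ) (σ * τ / √μ) η : ℂ)) * (bqW η : ℂ)) k,
    norm_smul, Real.norm_eq_abs, abs_abs, abs_of_pos (inv_pos.2 hkpos)]
  have hTabs : |σ * τ / √μ| ^ (-(1 : ℝ) / 3) = |τ| ^ (-(1 : ℝ) / 3) * μ ^ ((1 : ℝ) / 6) := by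
    rw [abs_div, abs_mul, hσ1, one_mul, abs_of_pos hs, Real.div_rpow (abs_nonneg _) hs.le,
      Real.sqrt_eq_rpow, ← Real.rpow_mul hμ.le, div_eq_mul_inv, ← Real.rpow_neg hμ.le]
    norm_num
  have hC0 : 0 ≤ C * |σ * τ / √μ| ^ (-(1 : ℝ) / 3) := (norm_nonneg _).trans h
  have hkinv : k⁻¹ ≤ μ ^ (-(1 : ℝ) / 2) := by
    have : μ ^ (-(1 : ℝ) / 2) = (√μ)⁻¹ := by
      rw [Real.sqrt_eq_rpow, ← Real.rpow_neg hμ.le]; norm_num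
    rw [this]
    refine inv_anti₀ hs ?_
    rw [hk]
    have := Real.pi_gt_three
    nlinarith
  calc _ ≤ μ ^ (-(1 : ℝ) / 2) * (C * |σ * τ / √μ| ^ (-(1 : ℝ) / 3)) := by
        refine mul_le_mul hkinv h (norm_nonneg _) (by positivity)
    _ = C * (μ ^ (-(1 : ℝ) / 2) * μ ^ ((1 : ℝ) / 6)) * |τ| ^ (-(1 : ℝ) / 3) := by rw [hTabs]; ring
    _ = _ := by rw [← Real.rpow_add hμ]; norm_num

lemma prop1_cont (σ τ μ : ℝ) (hμ : 0 < μ) : Continuous (prop1 σ τ μ) := by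
  unfold prop1
  have : Continuous fun ξ : ℝ => σ * τ * ξ / √(1 + μ * ξ ^ 2 / 3) :=
    Continuous.div (by fun_prop) (by fun_prop) fun x => (Real.sqrt_pos.2 (by positivity)).ne'
  fun_prop

lemma fmult1_prop_bound (A : ℝ) (f g : SchwartzMap ℝ ℂ) (σ τ μ : ℝ) (hμ : 0 < μ)
    (hg : ∀ η : ℝ, 𝓕 (⇑f) η = (bqW (2 * π * √μ * η) : ℂ) * 𝓕 (⇑g) η)
    (hA : ∀ z, ‖∫ η : ℝ, Complex.exp (Complex.I * (z * (2 * π * η) : ℝ)) *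
      prop1 σ τ μ (2 * π * η) * (bqW (2 * π * √μ * η) : ℂ)‖ ≤ A) (x : ℝ) :
    ‖fmult1 (fun ξ => prop1 σ τ μ ξ) ⇑f x‖ ≤ A * ∫ y, ‖g y‖ := by
  have hs : 0 < √μ := Real.sqrt_pos.2 hμ
  set k := 2 * π * √μ with hk
  have hkpos : 0 < k := by positivity
  have cw := bqW_cont
  have cp := prop1_cont σ τ μ hμ
  have np : ∀ ξ, ‖prop1 σ τ μ ξ‖ = 1 := by
    intro ξ
    unfold prop1
    rw [mul_comm Complex.I, Complex.norm_exp_ofReal_mul_I]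
  have e1 : fmult1 (fun ξ => prop1 σ τ μ ξ) ⇑f x = ∫ η : ℝ, ∫ y : ℝ,
      (Complex.exp (Complex.I * ((x - y) * (2 * π * η) : ℝ)) *
        prop1 σ τ μ (2 * π * η) * (bqW (k * η) : ℂ)) * g y := by
    rw [fmult1_eq]
    congr 1
    ext η
    rw [hg, Real.fourier_real_eq_integral_exp_smul, ← mul_assoc, ← integral_const_mul]
    congr 1
    ext y
    have : Complex.exp (Complex.I * ((x - y) * (2 * π * η) : ℝ)) =
        Complex.exp (Complex.I * (x * (2 * π * η) : ℝ)) *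
          Complex.exp (↑(-2 * π * y * η) * Complex.I) := by
      rw [← Complex.exp_add]
      congr 1
      push_cast
      ring
    rw [this, smul_eq_mul]
    ring
  have hint : Integrable (Function.uncurry fun η y : ℝ =>
      (Complex.exp (Complex.I * ((x - y) * (2 * π * η) : ℝ)) *
        prop1 σ τ μ (2 * π * η) * (bqW (k * η) : ℂ)) * g y) (volume.prod volume) := by
    have h1 : Integrable (fun η : ℝ => bqW (k * η)) := bqW_int.comp_mul_left' hkpos.ne'
    have h2 : Integrable (fun y : ℝ => ‖g y‖) := g.integrable.norm
    refine (h1.mul_prod h2).mono' ?_ ?_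
    · have cg := g.continuous
      refine Continuous.aestronglyMeasurable ?_
      unfold Function.uncurry
      fun_prop
    · refine Filter.Eventually.of_forall fun p => ?_
      simp only [Function.uncurry]
      rw [norm_mul, norm_mul, norm_mul, np, mul_comm Complex.I, Complex.norm_exp_ofReal_mul_I,
        Complex.norm_real, Real.norm_eq_abs, abs_of_pos (bqW_pos _), one_mul, one_mul]
  rw [e1, integral_integral_swap hint, ← integral_const_mul]
  refine norm_integral_le_of_norm_le (g.integrable.norm.const_mul A) ?_
  refine Filter.Eventually.of_forall fun y => ?_
  rw [integral_mul_const, norm_mul]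
  gcongr
  exact hA (x - y)

/-- Dispersive decay for the 1D Boussinesq propagator:
`‖e^{±(t/ε)∂ₓ/√(1+μD²/3)} f‖_{L^∞} ≤ C μ^{-1/3} (ε/|t|)^{1/3} ‖(1+μD²)^{5/6} f‖_{L¹}`. -/
theorem stmt12 (σ : ℝ) (hσ : σ = 1 ∨ σ = -1) :
    ∃ C : ℝ, 0 < C ∧ ∀ f : SchwartzMap ℝ ℂ, ∀ t : ℝ, t ≠ 0 →
      ∀ μ ∈ Set.Ioc (0 : ℝ) 1, ∀ ε ∈ Set.Ioc (0 : ℝ) 1,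
        eLpNorm (fmult1 (fun ξ => prop1 σ (t / ε) μ ξ) ⇑f) ⊤ volume ≤
          ENNReal.ofReal (C * μ ^ (-(1 : ℝ) / 3) * (ε / |t|) ^ ((1 : ℝ) / 3)) *
            eLpNorm
              (fmult1 (fun ξ => (((1 + μ * ξ ^ 2) ^ ((5 : ℝ) / 6) : ℝ) : ℂ)) ⇑f) 1 volume := by
  obtain ⟨C, hC0, hC⟩ := bq_full
  refine ⟨C, hC0, fun f t ht μ hμ ε hε => ?_⟩
  obtain ⟨g, hg1, hg2⟩ := exists_g f μ hμ.1
  have hτ : t / ε ≠ 0 := div_ne_zero ht hε.1.ne'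
  have hb := fmult1_prop_bound _ f g σ (t / ε) μ hμ.1 hg2
    (fun z => bq_kernel C hC σ hσ μ (t / ε) z hμ.1 hτ)
  have e : |t / ε| ^ (-(1 : ℝ) / 3) = (ε / |t|) ^ ((1 : ℝ) / 3) := by
    rw [abs_div, abs_of_pos hε.1, ← inv_div, neg_div,
      Real.rpow_neg (by have := hε.1; positivity),
      Real.inv_rpow (by have := hε.1; positivity), inv_inv]
  rw [e] at hb
  rw [hg1, eLpNorm_one_eq_lintegral_enorm, ← ofReal_integral_norm_eq_lintegral_enorm g.integrable,
    ← ENNReal.ofReal_mul (by have := hμ.1; have := hε.1; positivity), eLpNorm_exponent_top]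
  exact eLpNormEssSup_le_of_ae_bound (Filter.Eventually.of_forall hb)
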